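/- Suppose Ω ⊂ ℝⁿ is a quasihyperbolically well behaved bounded domain and Ω' ⊂ ℝⁿ is a bounded QH-visibility domain. Then every isometry f : (Ω, k_Ω) → (Ω', k_{Ω'}) of the quasihyperbolic metrics extends to a continuous map F : Ω̄^Euc → Ω̄'^Euc between the Euclidean closures. -/

import Mathlib

open Metric Set Filter Topology MeasureTheory
open scoped NNReal ENNReal

noncomputable section

variable {E : Type*} [NormedAddCommGroup E] [NormedSpace ℝ E]

/-- The quasihyperbolic length of a path `γ : [a, b] → Ω`, i.e. `∫ ‖γ'(t)‖ / δ_Ω(γ t) dt`. -/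
def qhLength (Ω : Set E) (γ : ℝ → E) (a b : ℝ) : ℝ :=
  ∫ t in a..b, ‖deriv γ t‖ / infDist (γ t) Ωᶜ

/-- Admissible (Lipschitz, i.e. rectifiable) paths joining `x` to `y` inside `Ω`. -/
def qhAdmissible (Ω : Set E) (x y : E) (γ : ℝ → E) (a b : ℝ) : Prop :=
  a ≤ b ∧ γ a = x ∧ γ b = y ∧ (∀ t ∈ Icc a b, γ t ∈ Ω) ∧
    ∃ K : ℝ≥0, LipschitzOnWith K γ (Icc a b)

/-- The quasihyperbolic distance `k_Ω` on a domain `Ω`. -/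
def qhDist (Ω : Set E) (x y : E) : ℝ :=
  sInf { L : ℝ | ∃ γ a b, qhAdmissible Ω x y γ a b ∧ L = qhLength Ω γ a b }

/-- `γ` is a (unit-speed) quasihyperbolic geodesic on the parameter set `s`. -/
def IsQHGeodesicOn (Ω : Set E) (γ : ℝ → E) (s : Set ℝ) : Prop :=
  (∀ t ∈ s, γ t ∈ Ω) ∧ ∀ a ∈ s, ∀ b ∈ s, qhDist Ω (γ a) (γ b) = |a - b|

/-- `Ω` is a QH-visibility domain: any two distinct Euclidean boundary points have
neighbourhoods with disjoint closures together with a compact subset of `Ω` which is met by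
every quasihyperbolic geodesic joining the two neighbourhoods. -/
def QHVisibilityDomain (Ω : Set E) : Prop :=
  ∀ p ∈ frontier Ω, ∀ q ∈ frontier Ω, p ≠ q →
    ∃ U V : Set E, IsOpen U ∧ IsOpen V ∧ p ∈ U ∧ q ∈ V ∧
      closure U ∩ closure V = ∅ ∧
      ∃ K : Set E, IsCompact K ∧ K ⊆ Ω ∧
        ∀ (γ : ℝ → E) (T : ℝ), 0 ≤ T → IsQHGeodesicOn Ω γ (Icc 0 T) →
          γ 0 ∈ U → γ T ∈ V → ∃ t ∈ Icc 0 T, γ t ∈ K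

/-- The quasihyperbolic distance from a point to a set. -/
def qhDistToSet (Ω : Set E) (x : E) (S : Set E) : ℝ :=
  sInf (qhDist Ω x '' S)

/-- `Ω` is quasihyperbolically well behaved: whenever two sequences in `Ω` converge to the
same Euclidean boundary point, the quasihyperbolic distance from any fixed point of `Ω` to
any quasihyperbolic geodesics joining them tends to infinity. -/
def QHWellBehaved (Ω : Set E) : Prop :=
  ∀ p ∈ frontier Ω, ∀ (x y : ℕ → E) (γ : ℕ → ℝ → E) (a b : ℕ → ℝ),
    (∀ k, x k ∈ Ω) → (∀ k, y k ∈ Ω) →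
    Tendsto x atTop (𝓝 p) → Tendsto y atTop (𝓝 p) →
    (∀ k, a k ≤ b k) → (∀ k, IsQHGeodesicOn Ω (γ k) (Icc (a k) (b k))) →
    (∀ k, γ k (a k) = x k) → (∀ k, γ k (b k) = y k) →
    ∀ x₀ ∈ Ω, Tendsto (fun k => qhDistToSet Ω x₀ (γ k '' Icc (a k) (b k))) atTop atTop

section Paths

set_option linter.unusedSectionVars false

variable {Ω : Set E} {x y z : E} {γ : ℝ → E} {a b : ℝ}

lemma infDist_compl_pos (hΩ : IsOpen Ω) (hne : (Ωᶜ).Nonempty) (hx : x ∈ Ω) :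
    0 < infDist x Ωᶜ :=
  (hΩ.isClosed_compl.notMem_iff_infDist_pos hne).1 (by simpa using hx)

lemma qhAdmissible.continuousOn (h : qhAdmissible Ω x y γ a b) : ContinuousOn γ (Icc a b) := by
  obtain ⟨-, -, -, -, K, hK⟩ := h
  exact hK.continuousOn

lemma qhAdmissible.subpath (h : qhAdmissible Ω x y γ a b) {s t : ℝ} (hs : a ≤ s) (hst : s ≤ t)
    (ht : t ≤ b) : qhAdmissible Ω (γ s) (γ t) γ s t := by
  obtain ⟨-, -, -, hmem, K, hK⟩ := h
  exact ⟨hst, rfl, rfl, fun u hu => hmem u (Icc_subset_Icc hs ht hu), K,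
    hK.mono (Icc_subset_Icc hs ht)⟩

/-- Along an admissible path the distance to the complement is bounded below. -/
lemma qhAdmissible.exists_infDist_lower_bound (hΩ : IsOpen Ω) (hne : (Ωᶜ).Nonempty)
    (h : qhAdmissible Ω x y γ a b) : ∃ m > 0, ∀ t ∈ Icc a b, m ≤ infDist (γ t) Ωᶜ := by
  obtain ⟨t₀, ht₀, hmin⟩ := isCompact_Icc.exists_isMinOn (nonempty_Icc.2 h.1)
    ((continuous_infDist_pt Ωᶜ).comp_continuousOn h.continuousOn)
  exact ⟨_, infDist_compl_pos hΩ hne (h.2.2.2.1 t₀ ht₀), fun t ht => hmin ht⟩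

lemma qhLength_nonneg (hab : a ≤ b) : 0 ≤ qhLength Ω γ a b :=
  intervalIntegral.integral_nonneg hab fun _ _ => div_nonneg (norm_nonneg _) infDist_nonneg

lemma qhAdmissible.intervalIntegrable [CompleteSpace E] (hΩ : IsOpen Ω) (hne : (Ωᶜ).Nonempty)
    (h : qhAdmissible Ω x y γ a b) :
    IntervalIntegrable (fun t => ‖deriv γ t‖ / infDist (γ t) Ωᶜ) volume a b := by
  obtain ⟨m, hm, hmle⟩ := h.exists_infDist_lower_bound hΩ hne
  obtain ⟨K, hK⟩ := h.2.2.2.2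
  rw [intervalIntegrable_iff_integrableOn_Ioo_of_le h.1]
  refine Integrable.mono' (g := fun _ => K / m) (integrable_const _) ?_ ?_
  · refine ((aestronglyMeasurable_deriv γ _).norm.aemeasurable.div ?_).aestronglyMeasurable
    exact ((continuous_infDist_pt Ωᶜ).comp_continuousOn
      (h.continuousOn.mono Ioo_subset_Icc_self)).aemeasurable measurableSet_Ioo
  · filter_upwards [ae_restrict_mem measurableSet_Ioo] with t ht
    rw [Real.norm_of_nonneg (div_nonneg (norm_nonneg _) infDist_nonneg)]
    exact div_le_div₀ K.2 (norm_deriv_le_of_lipschitzOn (Icc_mem_nhds ht.1 ht.2) hK) hm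
      (hmle t (Ioo_subset_Icc_self ht))

lemma qhLength_add [CompleteSpace E] (hΩ : IsOpen Ω) (hne : (Ωᶜ).Nonempty)
    (h : qhAdmissible Ω x y γ a b) {s t : ℝ} (hs : a ≤ s) (hst : s ≤ t) (ht : t ≤ b) :
    qhLength Ω γ a s + qhLength Ω γ s t = qhLength Ω γ a t :=
  intervalIntegral.integral_add_adjacent_intervals
    ((h.subpath le_rfl hs (hst.trans ht)).intervalIntegrable hΩ hne)
    ((h.subpath hs hst ht).intervalIntegrable hΩ hne)

lemma continuousOn_qhLength [CompleteSpace E] (hΩ : IsOpen Ω) (hne : (Ωᶜ).Nonempty)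
    (h : qhAdmissible Ω x y γ a b) : ContinuousOn (qhLength Ω γ a) (Icc a b) := by
  rw [← uIcc_of_le h.1]
  refine intervalIntegral.continuousOn_primitive_interval ?_
  rw [uIcc_of_le h.1]
  exact (intervalIntegrable_iff_integrableOn_Icc_of_le h.1).1 (h.intervalIntegrable hΩ hne)

/-- A `1`-Lipschitz real function does not increase the speed of a path. -/
lemma abs_deriv_comp_le_norm_deriv {φ : E → ℝ} (hφ : LipschitzWith 1 φ) {t : ℝ}
    (hγ : DifferentiableAt ℝ γ t) : |deriv (φ ∘ γ) t| ≤ ‖deriv γ t‖ := by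
  by_cases hd : DifferentiableAt ℝ (φ ∘ γ) t
  · refine le_of_tendsto_of_tendsto (hasDerivAt_iff_tendsto_slope.1 hd.hasDerivAt).abs
      (hasDerivAt_iff_tendsto_slope.1 hγ.hasDerivAt).norm (Eventually.of_forall fun s => ?_)
    simp only [slope, vsub_eq_sub, smul_eq_mul, abs_mul, norm_smul, Real.norm_eq_abs]
    gcongr
    simpa [Real.dist_eq, dist_eq_norm] using hφ.dist_le_mul (γ s) (γ t)
  · simp [deriv_zero_of_not_differentiableAt hd]

lemma LipschitzOnWith.ae_differentiableAt_Icc {F : Type*} [NormedAddCommGroup F] [NormedSpace ℝ F]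
    [FiniteDimensional ℝ F] {g : ℝ → F} {K : ℝ≥0} (hg : LipschitzOnWith K g (Icc a b)) :
    ∀ᵐ t, t ∈ Ioo a b → DifferentiableAt ℝ g t := by
  filter_upwards [hg.ae_differentiableWithinAt_of_mem_real] with t ht hmem
  exact (ht (Ioo_subset_Icc_self hmem)).differentiableAt (Icc_mem_nhds hmem.1 hmem.2)

/-- Comparison of the increment of a Lipschitz function with the quasihyperbolic length. -/
lemma qhAdmissible.abs_sub_le [CompleteSpace E] (hΩ : IsOpen Ω) (hne : (Ωᶜ).Nonempty)
    (h : qhAdmissible Ω x y γ a b) {ψ : ℝ → ℝ} {K : ℝ≥0} (hψ : LipschitzOnWith K ψ (Icc a b))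
    {C : ℝ} (hbound : ∀ᵐ t, t ∈ Ioo a b → |deriv ψ t| ≤ C * (‖deriv γ t‖ / infDist (γ t) Ωᶜ)) :
    |ψ b - ψ a| ≤ C * qhLength Ω γ a b := by
  rw [← uIcc_of_le h.1] at hψ
  rw [← hψ.absolutelyContinuousOnInterval.integral_deriv_eq_sub, qhLength,
    ← intervalIntegral.integral_const_mul, ← Real.norm_eq_abs]
  refine intervalIntegral.norm_integral_le_of_norm_le h.1 ?_
    ((h.intervalIntegrable hΩ hne).const_mul C)
  have hb : ∀ᵐ t : ℝ, t ≠ b := by simp [ae_iff]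
  filter_upwards [hbound, hb] with t ht htb hmem
  exact ht ⟨hmem.1, lt_of_le_of_ne hmem.2 htb⟩

/-- The quasihyperbolic length dominates the Euclidean distance if the distance to the complement
is bounded. -/
lemma qhAdmissible.norm_sub_le [FiniteDimensional ℝ E] (hΩ : IsOpen Ω) (hne : (Ωᶜ).Nonempty)
    {D : ℝ} (hD : ∀ z ∈ Ω, infDist z Ωᶜ ≤ D) (h : qhAdmissible Ω x y γ a b) :
    ‖y - x‖ ≤ D * qhLength Ω γ a b := by
  have : CompleteSpace E := FiniteDimensional.complete ℝ E
  obtain ⟨K, hK⟩ := h.2.2.2.2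
  have hφ : LipschitzWith 1 (fun z : E => dist z x) := LipschitzWith.dist_left x
  have key := h.abs_sub_le hΩ hne (hφ.comp_lipschitzOnWith hK) (C := D) (by
    filter_upwards [hK.ae_differentiableAt_Icc] with t ht hmem
    have hpos := infDist_compl_pos hΩ hne (h.2.2.2.1 t (Ioo_subset_Icc_self hmem))
    refine (abs_deriv_comp_le_norm_deriv hφ (ht hmem)).trans ?_
    rw [← mul_div_assoc, le_div_iff₀ hpos, mul_comm]
    exact mul_le_mul_of_nonneg_right (hD _ (h.2.2.2.1 t (Ioo_subset_Icc_self hmem)))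
      (norm_nonneg _))
  simpa [h.2.1, h.2.2.1, dist_eq_norm] using key

lemma Real.abs_log_sub_log_le {m u v : ℝ} (hm : 0 < m) (hu : m ≤ u) (hv : m ≤ v) :
    |Real.log u - Real.log v| ≤ m⁻¹ * |u - v| := by
  have hupos := hm.trans_le hu
  have hvpos := hm.trans_le hv
  have aux : ∀ {p q : ℝ}, m ≤ q → q ≤ p → Real.log p - Real.log q ≤ m⁻¹ * (p - q) := by
    intro p q hq hqp
    have hqpos := hm.trans_le hq
    rw [← Real.log_div (hqpos.trans_le hqp).ne' hqpos.ne']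
    calc Real.log (p / q) ≤ p / q - 1 := Real.log_le_sub_one_of_pos (div_pos (hqpos.trans_le hqp) hqpos)
      _ = q⁻¹ * (p - q) := by field_simp
      _ ≤ m⁻¹ * (p - q) := by gcongr
  rcases le_total u v with huv | huv
  · rw [abs_sub_comm, abs_sub_comm u, abs_of_nonneg (sub_nonneg.2 (Real.log_le_log hupos huv)),
      abs_of_nonneg (sub_nonneg.2 huv)]
    exact aux hu huv
  · rw [abs_of_nonneg (sub_nonneg.2 (Real.log_le_log hvpos huv)), abs_of_nonneg (sub_nonneg.2 huv)]
    exact aux hv huv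

/-- The logarithm of the distance to the complement is `1`-Lipschitz for the quasihyperbolic
length. -/
lemma qhAdmissible.abs_log_sub_log_le [FiniteDimensional ℝ E] (hΩ : IsOpen Ω)
    (hne : (Ωᶜ).Nonempty) (h : qhAdmissible Ω x y γ a b) :
    |Real.log (infDist y Ωᶜ) - Real.log (infDist x Ωᶜ)| ≤ qhLength Ω γ a b := by
  have : CompleteSpace E := FiniteDimensional.complete ℝ E
  obtain ⟨m, hm, hmle⟩ := h.exists_infDist_lower_bound hΩ hne
  obtain ⟨K, hK⟩ := h.2.2.2.2
  have hφ : LipschitzWith 1 (fun z : E => infDist z Ωᶜ) := lipschitz_infDist_pt _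
  have hg : LipschitzOnWith (1 * K) ((fun z : E => infDist z Ωᶜ) ∘ γ) (Icc a b) :=
    hφ.comp_lipschitzOnWith hK
  have hlog : LipschitzOnWith (m⁻¹.toNNReal * (1 * K)) (fun t => Real.log (infDist (γ t) Ωᶜ))
      (Icc a b) := by
    refine LipschitzOnWith.of_dist_le_mul fun s hs t ht => ?_
    have h1 := Real.abs_log_sub_log_le hm (hmle s hs) (hmle t ht)
    have h2 := hg.dist_le_mul s hs t ht
    have hm' : 0 ≤ m⁻¹ := inv_nonneg.2 hm.le
    rw [NNReal.coe_mul, Real.coe_toNNReal m⁻¹ hm', mul_assoc]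
    exact h1.trans (mul_le_mul_of_nonneg_left h2 hm')
  have key := h.abs_sub_le hΩ hne hlog (C := 1) (by
    filter_upwards [hK.ae_differentiableAt_Icc, hg.ae_differentiableAt_Icc] with t ht hgt hmem
    have hpos := infDist_compl_pos hΩ hne (h.2.2.2.1 t (Ioo_subset_Icc_self hmem))
    have hd : deriv (fun t => Real.log (infDist (γ t) Ωᶜ)) t =
        deriv ((fun z : E => infDist z Ωᶜ) ∘ γ) t / infDist (γ t) Ωᶜ :=
      ((hgt hmem).hasDerivAt.log hpos.ne').deriv
    rw [hd, one_mul, abs_div, abs_of_pos hpos]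
    exact div_le_div_of_nonneg_right (abs_deriv_comp_le_norm_deriv hφ (ht hmem)) hpos.le)
  simpa [h.2.1, h.2.2.1] using key

end Paths

section Distance

set_option linter.unusedSectionVars false

variable {Ω : Set E} {x y z : E} {γ γ₁ γ₂ : ℝ → E} {a b c d : ℝ}

/-- Reversal of an admissible path. -/
lemma qhAdmissible.symm (h : qhAdmissible Ω x y γ a b) :
    qhAdmissible Ω y x (fun t => γ (-t)) (-b) (-a) ∧
      qhLength Ω (fun t => γ (-t)) (-b) (-a) = qhLength Ω γ a b := by
  obtain ⟨hab, ha, hb, hmem, K, hK⟩ := h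
  have hneg : ∀ t ∈ Icc (-b) (-a), -t ∈ Icc a b := fun t ht =>
    ⟨by linarith [ht.2], by linarith [ht.1]⟩
  refine ⟨⟨by linarith, by simpa, by simpa, fun t ht => hmem _ (hneg t ht), K, ?_⟩, ?_⟩
  · refine LipschitzOnWith.of_dist_le_mul fun s hs t ht => ?_
    simpa using hK.dist_le_mul (-s) (hneg s hs) (-t) (hneg t ht)
  · simp only [qhLength, deriv_comp_neg, norm_neg]
    rw [intervalIntegral.integral_comp_neg fun t => ‖deriv γ t‖ / infDist (γ t) Ωᶜ]
    simp

/-- Concatenation of admissible paths. -/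
lemma qhAdmissible.trans [CompleteSpace E] (hΩ : IsOpen Ω) (hne : (Ωᶜ).Nonempty)
    (h₁ : qhAdmissible Ω x y γ₁ a b) (h₂ : qhAdmissible Ω y z γ₂ c d) :
    ∃ γ e, qhAdmissible Ω x z γ a e ∧
      qhLength Ω γ a e = qhLength Ω γ₁ a b + qhLength Ω γ₂ c d := by
  obtain ⟨hab, ha, hb, hmem₁, K₁, hK₁⟩ := h₁
  obtain ⟨hcd, hc, hd, hmem₂, K₂, hK₂⟩ := h₂
  set γ : ℝ → E := fun t => if t ≤ b then γ₁ t else γ₂ (t - (b - c)) with hγ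
  have hleft : ∀ {t}, t ≤ b → γ t = γ₁ t := fun ht => by simp [hγ, ht]
  have hright : ∀ {t}, b ≤ t → γ t = γ₂ (t - (b - c)) := by
    intro t ht
    rcases ht.eq_or_lt with rfl | ht
    · simp [hγ, hb, hc]
    · simp [hγ, ht.not_ge]
  have hshift : ∀ {t}, b ≤ t → t ≤ d + (b - c) → t - (b - c) ∈ Icc c d := fun h h' =>
    ⟨by linarith, by linarith⟩
  have hadm : qhAdmissible Ω x z γ a (d + (b - c)) := by
    refine ⟨by linarith, by rw [hleft hab, ha], ?_, fun t ht => ?_, K₁ + K₂, ?_⟩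
    · rw [hright (by linarith), add_sub_cancel_right, hd]
    · rcases le_total t b with htb | htb
      · rw [hleft htb]
        exact hmem₁ t ⟨ht.1, htb⟩
      · rw [hright htb]
        exact hmem₂ _ (hshift htb ht.2)
    · have aux : ∀ s ∈ Icc a (d + (b - c)), ∀ t ∈ Icc a (d + (b - c)), s ≤ t →
          dist (γ s) (γ t) ≤ (K₁ + K₂ : ℝ≥0) * dist s t := by
        intro s hs t ht hst
        have hK₁0 := K₁.2
        have hK₂0 := K₂.2
        rw [dist_comm s t, Real.dist_eq, abs_of_nonneg (sub_nonneg.2 hst)]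
        push_cast
        rcases le_total t b with htb | htb
        · rw [hleft htb, hleft (hst.trans htb)]
          have := hK₁.dist_le_mul s ⟨hs.1, hst.trans htb⟩ t ⟨ht.1, htb⟩
          rw [dist_comm s t, Real.dist_eq, abs_of_nonneg (sub_nonneg.2 hst)] at this
          nlinarith
        rcases le_total s b with hsb | hsb
        · have h1 := hK₁.dist_le_mul s ⟨hs.1, hsb⟩ b ⟨hab, le_rfl⟩
          have h2 := hK₂.dist_le_mul c ⟨le_rfl, hcd⟩ _ (hshift htb ht.2)
          rw [dist_comm s b, Real.dist_eq, abs_of_nonneg (sub_nonneg.2 hsb), hb] at h1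
          rw [dist_comm c, Real.dist_eq, abs_of_nonneg (by linarith), hc] at h2
          rw [hleft hsb, hright htb]
          have := dist_triangle (γ₁ s) y (γ₂ (t - (b - c)))
          nlinarith [mul_nonneg hK₁0 (sub_nonneg.2 htb), mul_nonneg hK₂0 (sub_nonneg.2 hsb)]
        · rw [hright hsb, hright htb]
          have := hK₂.dist_le_mul _ (hshift hsb hs.2) _ (hshift htb ht.2)
          rw [dist_sub_right, dist_comm s t, Real.dist_eq, abs_of_nonneg (sub_nonneg.2 hst)] at this
          nlinarith
      refine LipschitzOnWith.of_dist_le_mul fun s hs t ht => ?_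
      rcases le_total s t with hst | hst
      · exact aux s hs t ht hst
      · rw [dist_comm, dist_comm s]
        exact aux t ht s hs hst
  refine ⟨γ, _, hadm, ?_⟩
  rw [← qhLength_add hΩ hne hadm hab (by linarith : b ≤ d + (b - c)) le_rfl]
  congr 1
  · refine intervalIntegral.integral_congr_uIoo fun t ht => ?_
    rw [uIoo_of_le hab] at ht
    have : γ =ᶠ[𝓝 t] γ₁ := by
      filter_upwards [Iio_mem_nhds ht.2] with s hs using hleft (le_of_lt hs)
    simp only [this.deriv_eq, this.eq_of_nhds]
  · have hlen : qhLength Ω γ₂ c d = qhLength Ω (fun t => γ₂ (t - (b - c))) b (d + (b - c)) := by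
      simp only [qhLength, deriv_comp_sub_const]
      rw [intervalIntegral.integral_comp_sub_right
        (fun t => ‖deriv γ₂ t‖ / infDist (γ₂ t) Ωᶜ) (b - c)]
      simp
    rw [hlen]
    refine intervalIntegral.integral_congr_uIoo fun t ht => ?_
    rw [uIoo_of_le (by linarith)] at ht
    have : γ =ᶠ[𝓝 t] fun t => γ₂ (t - (b - c)) := by
      filter_upwards [Ioi_mem_nhds ht.1] with s hs using hright (le_of_lt hs)
    simp only [this.deriv_eq, this.eq_of_nhds]

/-- A short segment is admissible, with controlled quasihyperbolic length. -/
lemma exists_qhAdmissible_of_dist_le (hx : 0 < infDist x Ωᶜ)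
    (hxy : dist x y ≤ infDist x Ωᶜ / 2) :
    ∃ γ a b, qhAdmissible Ω x y γ a b ∧ qhLength Ω γ a b ≤ 2 / infDist x Ωᶜ * dist x y := by
  set γ : ℝ → E := ⇑(AffineMap.lineMap (k := ℝ) x y) with hγ
  have hlow : ∀ t ∈ Icc (0 : ℝ) 1, infDist x Ωᶜ / 2 ≤ infDist (γ t) Ωᶜ := by
    intro t ht
    have h1 : infDist x Ωᶜ ≤ infDist (γ t) Ωᶜ + dist x (γ t) := infDist_le_infDist_add_dist
    have h2 : dist x (γ t) = t * dist x y := by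
      rw [hγ, dist_left_lineMap, Real.norm_of_nonneg ht.1]
    nlinarith [mul_le_of_le_one_left (dist_nonneg (x := x) (y := y)) ht.2]
  have hderiv : ∀ t, deriv γ t = y - x := fun t =>
    (AffineMap.hasDerivAt_lineMap (𝕜 := ℝ) (a := x) (b := y) (x := t)).deriv
  refine ⟨γ, 0, 1, ⟨zero_le_one, by simp [hγ], by simp [hγ], fun t ht => ?_, nndist x y, ?_⟩, ?_⟩
  · by_contra hmem
    have h0 : infDist (γ t) Ωᶜ = 0 := infDist_zero_of_mem hmem
    linarith [hlow t ht]
  · exact (lipschitzWith_lineMap (𝕜 := ℝ) x y).lipschitzOnWith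
  · have key := intervalIntegral.norm_integral_le_of_norm_le_const (a := (0 : ℝ)) (b := 1)
      (f := fun t => ‖deriv γ t‖ / infDist (γ t) Ωᶜ) (C := 2 / infDist x Ωᶜ * dist x y) (by
        intro t ht
        rw [uIoc_of_le zero_le_one] at ht
        rw [Real.norm_of_nonneg (div_nonneg (norm_nonneg _) infDist_nonneg), hderiv,
          dist_comm, dist_eq_norm, div_mul_eq_mul_div, mul_comm, ← div_div_eq_mul_div]
        exact div_le_div_of_nonneg_left (norm_nonneg _) (by positivity)
          (hlow t (Ioc_subset_Icc_self ht)))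
    simpa [qhLength] using (le_abs_self _).trans key

lemma exists_qhAdmissible [CompleteSpace E] (hΩ : IsOpen Ω) (hne : (Ωᶜ).Nonempty)
    (hconn : IsPreconnected Ω) (hx : x ∈ Ω) (hy : y ∈ Ω) : ∃ γ a b, qhAdmissible Ω x y γ a b := by
  refine hconn.induction₂ (fun x y => ∃ γ a b, qhAdmissible Ω x y γ a b) (fun x hx => ?_)
    (fun x y z _ _ _ => ?_) (fun x y _ _ => ?_) hx hy
  · have hpos := infDist_compl_pos hΩ hne hx
    filter_upwards [mem_nhdsWithin_of_mem_nhds (closedBall_mem_nhds x (half_pos hpos))] with y hy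
    obtain ⟨γ, a, b, h, -⟩ := exists_qhAdmissible_of_dist_le hpos (mem_closedBall'.1 hy)
    exact ⟨γ, a, b, h⟩
  · rintro ⟨γ₁, a, b, h₁⟩ ⟨γ₂, c, d, h₂⟩
    obtain ⟨γ, e, h, -⟩ := h₁.trans hΩ hne h₂
    exact ⟨γ, a, e, h⟩
  · rintro ⟨γ, a, b, h⟩
    exact ⟨_, _, _, h.symm.1⟩

lemma qhDist_nonneg : 0 ≤ qhDist Ω x y :=
  Real.sInf_nonneg fun _ ⟨_, _, _, h, hL⟩ => hL ▸ qhLength_nonneg h.1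

lemma qhAdmissible.qhDist_le (h : qhAdmissible Ω x y γ a b) : qhDist Ω x y ≤ qhLength Ω γ a b :=
  csInf_le ⟨0, fun _ ⟨_, _, _, h, hL⟩ => hL ▸ qhLength_nonneg h.1⟩ ⟨γ, a, b, h, rfl⟩

lemma qhDist_comm (x y : E) : qhDist Ω x y = qhDist Ω y x := by
  have aux : ∀ {x y L}, (∃ γ a b, qhAdmissible Ω x y γ a b ∧ L = qhLength Ω γ a b) →
      ∃ γ a b, qhAdmissible Ω y x γ a b ∧ L = qhLength Ω γ a b := by
    rintro x y L ⟨γ, a, b, h, rfl⟩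
    exact ⟨_, _, _, h.symm.1, h.symm.2.symm⟩
  exact congrArg sInf (Set.ext fun L => ⟨aux, aux⟩)

lemma exists_qhLength_lt [CompleteSpace E] (hΩ : IsOpen Ω) (hne : (Ωᶜ).Nonempty)
    (hconn : IsPreconnected Ω) (hx : x ∈ Ω) (hy : y ∈ Ω) {ε : ℝ} (hε : 0 < ε) :
    ∃ γ a b, qhAdmissible Ω x y γ a b ∧ qhLength Ω γ a b < qhDist Ω x y + ε := by
  obtain ⟨γ, a, b, h⟩ := exists_qhAdmissible hΩ hne hconn hx hy
  obtain ⟨L, ⟨γ', a', b', h', rfl⟩, hL⟩ := exists_lt_of_csInf_lt (s := { L : ℝ | ∃ γ a b,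
    qhAdmissible Ω x y γ a b ∧ L = qhLength Ω γ a b }) ⟨_, γ, a, b, h, rfl⟩
    (lt_add_of_pos_right (qhDist Ω x y) hε)
  exact ⟨γ', a', b', h', hL⟩

lemma qhDist_triangle [CompleteSpace E] (hΩ : IsOpen Ω) (hne : (Ωᶜ).Nonempty)
    (hconn : IsPreconnected Ω) (hx : x ∈ Ω) (hy : y ∈ Ω) (hz : z ∈ Ω) :
    qhDist Ω x z ≤ qhDist Ω x y + qhDist Ω y z := by
  refine le_of_forall_pos_le_add fun ε hε => ?_
  obtain ⟨γ₁, a, b, h₁, hL₁⟩ := exists_qhLength_lt hΩ hne hconn hx hy (half_pos hε)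
  obtain ⟨γ₂, c, d, h₂, hL₂⟩ := exists_qhLength_lt hΩ hne hconn hy hz (half_pos hε)
  obtain ⟨γ, e, h, hL⟩ := h₁.trans hΩ hne h₂
  linarith [h.qhDist_le]

lemma qhDist_le_of_dist_le (hx : 0 < infDist x Ωᶜ) (hxy : dist x y ≤ infDist x Ωᶜ / 2) :
    qhDist Ω x y ≤ 2 / infDist x Ωᶜ * dist x y := by
  obtain ⟨γ, a, b, h, hL⟩ := exists_qhAdmissible_of_dist_le hx hxy
  exact h.qhDist_le.trans hL

lemma qhDist_self (hx : 0 < infDist x Ωᶜ) : qhDist Ω x x = 0 :=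
  le_antisymm (by simpa using qhDist_le_of_dist_le (y := x) hx (by simpa using (half_pos hx).le))
    qhDist_nonneg

/-- The quasihyperbolic distance to a point of `Ω` tends to zero at that point. -/
lemma tendsto_qhDist_nhds (hΩ : IsOpen Ω) (hne : (Ωᶜ).Nonempty) (hx : x ∈ Ω) :
    Tendsto (qhDist Ω x) (𝓝 x) (𝓝 0) := by
  have hpos := infDist_compl_pos hΩ hne hx
  have hlim : Tendsto (fun y => 2 / infDist x Ωᶜ * dist x y) (𝓝 x) (𝓝 0) := by
    have : Continuous fun y => 2 / infDist x Ωᶜ * dist x y := by fun_prop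
    simpa using this.tendsto x
  refine squeeze_zero' (Eventually.of_forall fun _ => qhDist_nonneg) ?_ hlim
  filter_upwards [closedBall_mem_nhds x (half_pos hpos)] with y hy
  exact qhDist_le_of_dist_le hpos (mem_closedBall'.1 hy)

lemma dist_le_mul_qhDist [FiniteDimensional ℝ E] (hΩ : IsOpen Ω) (hne : (Ωᶜ).Nonempty)
    (hconn : IsPreconnected Ω) {D : ℝ} (hD : ∀ z ∈ Ω, infDist z Ωᶜ ≤ D) (hx : x ∈ Ω)
    (hy : y ∈ Ω) : dist x y ≤ D * qhDist Ω x y := by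
  have : CompleteSpace E := FiniteDimensional.complete ℝ E
  have hD0 : 0 < D := (infDist_compl_pos hΩ hne hx).trans_le (hD x hx)
  rw [← div_le_iff₀' hD0]
  refine le_of_forall_pos_le_add fun ε hε => ?_
  obtain ⟨γ, a, b, h, hL⟩ := exists_qhLength_lt hΩ hne hconn hx hy hε
  rw [div_le_iff₀' hD0, dist_comm, dist_eq_norm]
  exact (h.norm_sub_le hΩ hne hD).trans (mul_le_mul_of_nonneg_left hL.le hD0.le)

/-- Joint continuity of the quasihyperbolic distance. -/
lemma tendsto_qhDist [CompleteSpace E] (hΩ : IsOpen Ω) (hne : (Ωᶜ).Nonempty)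
    (hconn : IsPreconnected Ω) {ι : Type*} {l : Filter ι} {u v : ι → E} (hx : x ∈ Ω) (hy : y ∈ Ω)
    (hu : Tendsto u l (𝓝 x)) (hv : Tendsto v l (𝓝 y)) :
    Tendsto (fun i => qhDist Ω (u i) (v i)) l (𝓝 (qhDist Ω x y)) := by
  rw [tendsto_iff_dist_tendsto_zero]
  have h0 := ((tendsto_qhDist_nhds hΩ hne hx).comp hu).add
    ((tendsto_qhDist_nhds hΩ hne hy).comp hv)
  rw [add_zero] at h0
  refine squeeze_zero' (Eventually.of_forall fun _ => dist_nonneg) ?_ h0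
  filter_upwards [hu (hΩ.mem_nhds hx), hv (hΩ.mem_nhds hy)] with i hui hvi
  have h1 := qhDist_triangle hΩ hne hconn hui hx hvi
  have h2 := qhDist_triangle hΩ hne hconn hx hy hvi
  have h3 := qhDist_triangle hΩ hne hconn hx hui hy
  have h4 := qhDist_triangle hΩ hne hconn hui hvi hy
  rw [qhDist_comm (u i) x] at h1
  rw [qhDist_comm (v i) y] at h4
  rw [Real.dist_eq, abs_le]
  constructor <;> simp only [Function.comp_apply] <;> linarith

end Distance

section Geodesics

set_option linter.unusedSectionVars false

variable {Ω : Set E} {x y : E}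

lemma exists_infDist_compl_le (hbdd : Bornology.IsBounded Ω) (hne : (Ωᶜ).Nonempty) :
    ∃ D, ∀ z ∈ Ω, infDist z Ωᶜ ≤ D := by
  obtain ⟨p, hp⟩ := hne
  obtain ⟨D, hD⟩ := hbdd.subset_closedBall p
  exact ⟨D, fun z hz => (infDist_le_dist_of_mem hp).trans (hD hz)⟩

variable [FiniteDimensional ℝ E]

lemma infDist_compl_mul_exp_le (hΩ : IsOpen Ω) (hne : (Ωᶜ).Nonempty) (hconn : IsPreconnected Ω)
    (hx : x ∈ Ω) (hy : y ∈ Ω) :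
    infDist x Ωᶜ * Real.exp (-qhDist Ω x y) ≤ infDist y Ωᶜ := by
  have : CompleteSpace E := FiniteDimensional.complete ℝ E
  have hxpos := infDist_compl_pos hΩ hne hx
  have hypos := infDist_compl_pos hΩ hne hy
  have hlog : Real.log (infDist x Ωᶜ) - Real.log (infDist y Ωᶜ) ≤ qhDist Ω x y := by
    refine le_of_forall_pos_le_add fun ε hε => ?_
    obtain ⟨γ, a, b, h, hL⟩ := exists_qhLength_lt hΩ hne hconn hx hy hε
    linarith [neg_abs_le (Real.log (infDist y Ωᶜ) - Real.log (infDist x Ωᶜ)),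
      h.abs_log_sub_log_le hΩ hne]
  rw [← Real.log_le_log_iff (by positivity) hypos, Real.log_mul hxpos.ne' (Real.exp_ne_zero _),
    Real.log_exp]
  linarith

/-- Quasihyperbolic balls of a bounded domain are contained in compact subsets of the domain. -/
lemma exists_isCompact_of_qhDist_le (hΩ : IsOpen Ω) (hne : (Ωᶜ).Nonempty)
    (hconn : IsPreconnected Ω) (hbdd : Bornology.IsBounded Ω) (hx : x ∈ Ω) (R : ℝ) :
    ∃ K ⊆ Ω, IsCompact K ∧ ∀ z ∈ Ω, qhDist Ω x z ≤ R → z ∈ K := by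
  have : ProperSpace E := FiniteDimensional.proper_real E
  have hxpos := infDist_compl_pos hΩ hne hx
  refine ⟨closure Ω ∩ {z | infDist x Ωᶜ * Real.exp (-R) ≤ infDist z Ωᶜ}, fun z hz => ?_,
    hbdd.isCompact_closure.inter_right
      (isClosed_le continuous_const (continuous_infDist_pt _)), fun z hz hzR => ?_⟩
  · by_contra hmem
    have h1 : infDist x Ωᶜ * Real.exp (-R) ≤ infDist z Ωᶜ := hz.2
    have h0 : infDist z Ωᶜ = 0 := infDist_zero_of_mem hmem
    rw [h0] at h1
    exact absurd h1 (by positivity : 0 < infDist x Ωᶜ * Real.exp (-R)).not_ge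
  · refine ⟨subset_closure hz, le_trans ?_ (infDist_compl_mul_exp_le hΩ hne hconn hx hz)⟩
    gcongr

/-- An almost length-minimizing path, parametrized by quasihyperbolic arclength. -/
lemma exists_almost_qhGeodesic (hΩ : IsOpen Ω) (hne : (Ωᶜ).Nonempty)
    (hconn : IsPreconnected Ω) (hx : x ∈ Ω) (hy : y ∈ Ω) {ε : ℝ} (hε : 0 < ε) :
    ∃ σ : ℝ → E, ∀ s ∈ Icc 0 (qhDist Ω x y), σ s ∈ Ω ∧ qhDist Ω x (σ s) ≤ s ∧
      qhDist Ω (σ s) y ≤ qhDist Ω x y - s + ε ∧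
      ∀ t ∈ Icc 0 (qhDist Ω x y), qhDist Ω (σ s) (σ t) ≤ |s - t| := by
  have : CompleteSpace E := FiniteDimensional.complete ℝ E
  obtain ⟨γ, a, b, h, hL⟩ := exists_qhLength_lt hΩ hne hconn hx hy hε
  have hpar : ∀ s, ∃ t, s ∈ Icc 0 (qhDist Ω x y) → t ∈ Icc a b ∧ qhLength Ω γ a t = s := by
    intro s
    by_cases hs : s ∈ Icc 0 (qhDist Ω x y)
    · have hs' : s ∈ Icc (qhLength Ω γ a a) (qhLength Ω γ a b) :=
        ⟨by simpa [qhLength] using hs.1, hs.2.trans h.qhDist_le⟩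
      obtain ⟨t, ht, hts⟩ := intermediate_value_Icc h.1 (continuousOn_qhLength hΩ hne h) hs'
      exact ⟨t, fun _ => ⟨ht, hts⟩⟩
    · exact ⟨0, fun h' => absurd h' hs⟩
  choose τ hτ using hpar
  have hsub : ∀ {s t}, a ≤ s → s ≤ t → t ≤ b →
      qhDist Ω (γ s) (γ t) ≤ qhLength Ω γ a t - qhLength Ω γ a s := by
    intro s t hs hst ht
    linarith [(h.subpath hs hst ht).qhDist_le, qhLength_add hΩ hne h hs hst ht]
  refine ⟨fun s => γ (τ s), fun s hs => ?_⟩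
  obtain ⟨⟨has, hsb⟩, hls⟩ := hτ s hs
  refine ⟨h.2.2.2.1 _ ⟨has, hsb⟩, ?_, ?_, fun t ht => ?_⟩
  · have := hsub le_rfl has hsb
    rw [h.2.1, hls] at this
    linarith [qhLength_nonneg (Ω := Ω) (γ := γ) (le_refl a)]
  · have := hsub has hsb le_rfl
    rw [h.2.2.1, hls] at this
    linarith
  · obtain ⟨⟨hat, htb⟩, hlt⟩ := hτ t ht
    rcases le_total (τ s) (τ t) with hst | hst
    · rw [abs_sub_comm]
      refine le_trans (hsub has hst htb) ?_
      rw [hls, hlt]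
      exact le_abs_self _
    · rw [qhDist_comm]
      refine le_trans (hsub hat hst hsb) ?_
      rw [hls, hlt]
      exact le_abs_self _

/-- Any two points of a bounded domain are joined by a quasihyperbolic geodesic. -/
theorem exists_qhGeodesic (hΩ : IsOpen Ω) (hne : (Ωᶜ).Nonempty) (hconn : IsPreconnected Ω)
    (hbdd : Bornology.IsBounded Ω) (hx : x ∈ Ω) (hy : y ∈ Ω) :
    ∃ γ : ℝ → E, IsQHGeodesicOn Ω γ (Icc 0 (qhDist Ω x y)) ∧ γ 0 = x ∧ γ (qhDist Ω x y) = y := by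
  have : CompleteSpace E := FiniteDimensional.complete ℝ E
  set L := qhDist Ω x y with hLdef
  have hL : 0 ≤ L := qhDist_nonneg
  choose σ hσ using fun k : ℕ =>
    exists_almost_qhGeodesic hΩ hne hconn hx hy (Nat.one_div_pos_of_nat (α := ℝ) (n := k))
  rw [← hLdef] at hσ
  obtain ⟨K, hKΩ, hK, hmemK⟩ := exists_isCompact_of_qhDist_le hΩ hne hconn hbdd hx L
  have hlim : ∀ s, ∃ p, s ∈ Icc 0 L →
      p ∈ Ω ∧ Tendsto (fun k => σ k s) (hyperfilter ℕ : Filter ℕ) (𝓝 p) := by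
    intro s
    by_cases hs : s ∈ Icc 0 L
    · obtain ⟨p, hp, hle⟩ := hK.ultrafilter_le_nhds' ((hyperfilter ℕ).map fun k => σ k s)
        (Ultrafilter.mem_map.2 (Filter.univ_mem' fun k =>
          hmemK _ (hσ k s hs).1 ((hσ k s hs).2.1.trans hs.2)))
      exact ⟨p, fun _ => ⟨hKΩ hp, hle⟩⟩
    · exact ⟨0, fun h' => absurd h' hs⟩
  choose γ hγ using hlim
  have hx' : ∀ s ∈ Icc 0 L, qhDist Ω x (γ s) ≤ s := fun s hs =>
    le_of_tendsto' (tendsto_qhDist hΩ hne hconn hx (hγ s hs).1 tendsto_const_nhds (hγ s hs).2)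
      fun k => (hσ k s hs).2.1
  have hy' : ∀ s ∈ Icc 0 L, qhDist Ω (γ s) y ≤ L - s := fun s hs => by
    have hε : Tendsto (fun k : ℕ => L - s + 1 / ((k : ℝ) + 1)) (hyperfilter ℕ : Filter ℕ)
        (𝓝 (L - s)) := by
      simpa using ((tendsto_one_div_add_atTop_nhds_zero_nat (𝕜 := ℝ)).mono_left
        Nat.hyperfilter_le_atTop).const_add (L - s)
    exact le_of_tendsto_of_tendsto'
      (tendsto_qhDist hΩ hne hconn (hγ s hs).1 hy (hγ s hs).2 tendsto_const_nhds) hε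
      fun k => (hσ k s hs).2.2.1
  have hle : ∀ s ∈ Icc 0 L, ∀ t ∈ Icc 0 L, qhDist Ω (γ s) (γ t) ≤ |s - t| := fun s hs t ht =>
    le_of_tendsto' (tendsto_qhDist hΩ hne hconn (hγ s hs).1 (hγ t ht).1 (hγ s hs).2 (hγ t ht).2)
      fun k => (hσ k s hs).2.2.2 t ht
  have hge : ∀ s ∈ Icc 0 L, ∀ t ∈ Icc 0 L, t - s ≤ qhDist Ω (γ s) (γ t) := fun s hs t ht => by
    have h1 := qhDist_triangle hΩ hne hconn hx (hγ s hs).1 hy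
    have h2 := qhDist_triangle hΩ hne hconn (hγ s hs).1 (hγ t ht).1 hy
    linarith [hx' s hs, hy' t ht]
  obtain ⟨D, hD⟩ := exists_infDist_compl_le hbdd hne
  have heq : ∀ {u v}, u ∈ Ω → v ∈ Ω → qhDist Ω u v ≤ 0 → u = v := fun hu hv h => by
    have := dist_le_mul_qhDist hΩ hne hconn hD hu hv
    rw [le_antisymm h qhDist_nonneg, mul_zero] at this
    exact dist_le_zero.1 this
  have h0 : (0 : ℝ) ∈ Icc 0 L := ⟨le_rfl, hL⟩
  have h1 : L ∈ Icc 0 L := ⟨hL, le_rfl⟩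
  refine ⟨γ, ⟨fun s hs => (hγ s hs).1, fun s hs t ht => le_antisymm (hle s hs t ht) ?_⟩,
    (heq hx (hγ 0 h0).1 (hx' 0 h0)).symm, heq (hγ L h1).1 hy (by simpa using hy' L h1)⟩
  refine abs_le.2 ⟨?_, ?_⟩
  · linarith [hge s hs t ht]
  · rw [qhDist_comm]
    exact hge t ht s hs

end Geodesics

section Extension

set_option linter.unusedSectionVars false

variable {Ω Ω' : Set E} {f : E → E}

lemma IsQHGeodesicOn.comp_isometry {γ : ℝ → E} {s : Set ℝ} (hγ : IsQHGeodesicOn Ω γ s)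
    (hmaps : MapsTo f Ω Ω')
    (hiso : ∀ x ∈ Ω, ∀ y ∈ Ω, qhDist Ω' (f x) (f y) = qhDist Ω x y) :
    IsQHGeodesicOn Ω' (f ∘ γ) s :=
  ⟨fun t ht => hmaps (hγ.1 t ht), fun a ha b hb =>
    (hiso _ (hγ.1 a ha) _ (hγ.1 b hb)).trans (hγ.2 a ha b hb)⟩

lemma qhDistToSet_le {x y : E} {S : Set E} (hy : y ∈ S) : qhDistToSet Ω x S ≤ qhDist Ω x y :=
  csInf_le ⟨0, forall_mem_image.2 fun _ _ => qhDist_nonneg⟩ (mem_image_of_mem _ hy)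

/-- In a well behaved domain the quasihyperbolic distance blows up at the boundary. -/
lemma QHWellBehaved.tendsto_qhDist_atTop (hΩ : IsOpen Ω) (hne : (Ωᶜ).Nonempty)
    (hWB : QHWellBehaved Ω) {p x₀ : E} (hp : p ∈ frontier Ω) (hx₀ : x₀ ∈ Ω) {u : ℕ → E}
    (huΩ : ∀ k, u k ∈ Ω) (hu : Tendsto u atTop (𝓝 p)) :
    Tendsto (fun k => qhDist Ω x₀ (u k)) atTop atTop := by
  refine tendsto_atTop_mono (fun k => ?_) (hWB p hp u u (fun k _ => u k) (fun _ => 0) (fun _ => 0)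
    huΩ huΩ hu hu (fun _ => le_rfl) (fun k => ⟨fun _ _ => huΩ k, fun a ha b hb => ?_⟩)
    (fun _ => rfl) (fun _ => rfl) x₀ hx₀)
  · exact qhDistToSet_le ⟨0, ⟨le_rfl, le_rfl⟩, rfl⟩
  · rw [Icc_self, mem_singleton_iff] at ha hb
    rw [ha, hb, sub_self, abs_zero, qhDist_self (infDist_compl_pos hΩ hne (huΩ k))]

lemma exists_seq_of_mapClusterPt {p q : E} (h : MapClusterPt q (𝓝[Ω] p) f) :
    ∃ u : ℕ → E, (∀ k, u k ∈ Ω) ∧ Tendsto u atTop (𝓝 p) ∧ Tendsto (f ∘ u) atTop (𝓝 q) := by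
  have hseq : ∀ k : ℕ, ∃ x ∈ Ω, dist x p < 1 / ((k : ℝ) + 1) ∧ dist (f x) q < 1 / ((k : ℝ) + 1) := by
    intro k
    have hk : (0 : ℝ) < 1 / ((k : ℝ) + 1) := by positivity
    obtain ⟨x, hfx, hxΩ, hxp⟩ := ((mapClusterPt_iff_frequently.1 h _
      (ball_mem_nhds q hk)).and_eventually ((eventually_mem_nhdsWithin).and
        (mem_nhdsWithin_of_mem_nhds (ball_mem_nhds p hk)))).exists
    exact ⟨x, hxΩ, hxp, hfx⟩
  choose u huΩ hup huq using hseq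
  exact ⟨u, huΩ,
    tendsto_iff_dist_tendsto_zero.2 (squeeze_zero (fun _ => dist_nonneg) (fun k => (hup k).le)
      tendsto_one_div_add_atTop_nhds_zero_nat),
    tendsto_iff_dist_tendsto_zero.2 (squeeze_zero (fun _ => dist_nonneg) (fun k => (huq k).le)
      tendsto_one_div_add_atTop_nhds_zero_nat)⟩

variable [FiniteDimensional ℝ E]

lemma continuousOn_of_qhDist_eq (hΩ : IsOpen Ω) (hne : (Ωᶜ).Nonempty) (hΩ' : IsOpen Ω')
    (hne' : (Ω'ᶜ).Nonempty) (hconn' : IsPreconnected Ω') (hbdd' : Bornology.IsBounded Ω')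
    (hmaps : MapsTo f Ω Ω')
    (hiso : ∀ x ∈ Ω, ∀ y ∈ Ω, qhDist Ω' (f x) (f y) = qhDist Ω x y) : ContinuousOn f Ω := by
  intro x hx
  obtain ⟨D, hD⟩ := exists_infDist_compl_le hbdd' hne'
  have hlim : Tendsto (fun y => D * qhDist Ω x y) (𝓝[Ω] x) (𝓝 0) := by
    simpa using ((tendsto_qhDist_nhds hΩ hne hx).mono_left nhdsWithin_le_nhds).const_mul D
  refine tendsto_iff_dist_tendsto_zero.2 (squeeze_zero' (Eventually.of_forall fun _ => dist_nonneg)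
    ?_ hlim)
  filter_upwards [self_mem_nhdsWithin] with y hy
  rw [dist_comm, ← hiso x hx y hy]
  exact dist_le_mul_qhDist hΩ' hne' hconn' hD (hmaps hx) (hmaps hy)

/-- Boundary cluster values of a quasihyperbolic isometry lie on the boundary. -/
lemma mem_frontier_of_tendsto (hΩ : IsOpen Ω) (hne : (Ωᶜ).Nonempty) (hΩne : Ω.Nonempty)
    (hΩ' : IsOpen Ω') (hne' : (Ω'ᶜ).Nonempty) (hconn' : IsPreconnected Ω') (hWB : QHWellBehaved Ω)
    (hmaps : MapsTo f Ω Ω')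
    (hiso : ∀ x ∈ Ω, ∀ y ∈ Ω, qhDist Ω' (f x) (f y) = qhDist Ω x y) {p q : E}
    (hp : p ∈ frontier Ω) {u : ℕ → E} (huΩ : ∀ k, u k ∈ Ω) (hu : Tendsto u atTop (𝓝 p))
    (hfu : Tendsto (f ∘ u) atTop (𝓝 q)) : q ∈ frontier Ω' := by
  have : CompleteSpace E := FiniteDimensional.complete ℝ E
  obtain ⟨x₀, hx₀⟩ := hΩne
  rw [hΩ'.frontier_eq]
  refine ⟨mem_closure_of_tendsto hfu (Eventually.of_forall fun k => hmaps (huΩ k)), fun hq => ?_⟩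
  have hlim := tendsto_qhDist hΩ' hne' hconn' (hmaps hx₀) hq tendsto_const_nhds hfu
  refine not_tendsto_nhds_of_tendsto_atTop (hWB.tendsto_qhDist_atTop hΩ hne hp hx₀ huΩ hu) _
    (hlim.congr fun k => hiso _ hx₀ _ (huΩ k))

lemma eq_of_tendsto_of_qhVisibility (hΩ : IsOpen Ω) (hne : (Ωᶜ).Nonempty) (hconn : IsConnected Ω)
    (hbdd : Bornology.IsBounded Ω) (hΩ' : IsOpen Ω') (hne' : (Ω'ᶜ).Nonempty)
    (hconn' : IsPreconnected Ω') (hWB : QHWellBehaved Ω) (hVis : QHVisibilityDomain Ω')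
    (hmaps : MapsTo f Ω Ω')
    (hiso : ∀ x ∈ Ω, ∀ y ∈ Ω, qhDist Ω' (f x) (f y) = qhDist Ω x y) {p q r : E}
    (hp : p ∈ frontier Ω) {u v : ℕ → E} (huΩ : ∀ k, u k ∈ Ω) (hvΩ : ∀ k, v k ∈ Ω)
    (hu : Tendsto u atTop (𝓝 p)) (hv : Tendsto v atTop (𝓝 p))
    (hfu : Tendsto (f ∘ u) atTop (𝓝 q)) (hfv : Tendsto (f ∘ v) atTop (𝓝 r)) : q = r := by
  have : CompleteSpace E := FiniteDimensional.complete ℝ E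
  by_contra hqr
  obtain ⟨x₀, hx₀⟩ := hconn.nonempty
  have hfrontier {q : E} {u : ℕ → E} := mem_frontier_of_tendsto (q := q) (u := u) hΩ hne
    hconn.nonempty hΩ' hne' hconn' hWB hmaps hiso hp
  obtain ⟨U, V, hU, hV, hqU, hrV, -, K, hK, hKΩ, hmeet⟩ :=
    hVis q (hfrontier huΩ hu hfu) r (hfrontier hvΩ hv hfv) hqr
  choose γ hγ hγ0 hγ1 using fun k =>
    exists_qhGeodesic hΩ hne hconn.isPreconnected hbdd (huΩ k) (hvΩ k)
  have hcont : ContinuousOn (qhDist Ω' (f x₀)) K := fun z hz =>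
    tendsto_qhDist hΩ' hne' hconn' (hmaps hx₀) (hKΩ hz) tendsto_const_nhds
      (tendsto_id.mono_left nhdsWithin_le_nhds)
  obtain ⟨M, hM⟩ := hK.bddAbove_image hcont
  have htop := hWB p hp u v γ (fun _ => 0) (fun k => qhDist Ω (u k) (v k)) huΩ hvΩ hu hv
    (fun _ => qhDist_nonneg) hγ hγ0 hγ1 x₀ hx₀
  obtain ⟨k, hkM, hkU, hkV⟩ := ((htop.eventually_gt_atTop M).and
    ((hfu.eventually (hU.mem_nhds hqU)).and (hfv.eventually (hV.mem_nhds hrV)))).exists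
  obtain ⟨t, ht, htK⟩ := hmeet (f ∘ γ k) _ qhDist_nonneg ((hγ k).comp_isometry hmaps hiso)
    (by simpa [hγ0] using show f (u k) ∈ U from hkU)
    (by simpa [hγ1] using show f (v k) ∈ V from hkV)
  have h1 : qhDist Ω x₀ (γ k t) ≤ M := by
    rw [← hiso x₀ hx₀ _ ((hγ k).1 t ht)]
    exact hM (mem_image_of_mem _ htK)
  exact absurd hkM ((qhDistToSet_le (mem_image_of_mem _ ht)).trans h1).not_gt

/-- Extension theorem for proper subdomains of a finite-dimensional normed space. -/
theorem exists_continuousOn_closure_extension (hΩ : IsOpen Ω) (hne : (Ωᶜ).Nonempty)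
    (hconn : IsConnected Ω) (hbdd : Bornology.IsBounded Ω) (hΩ' : IsOpen Ω')
    (hne' : (Ω'ᶜ).Nonempty) (hconn' : IsPreconnected Ω') (hbdd' : Bornology.IsBounded Ω')
    (hWB : QHWellBehaved Ω) (hVis : QHVisibilityDomain Ω') (hmaps : MapsTo f Ω Ω')
    (hiso : ∀ x ∈ Ω, ∀ y ∈ Ω, qhDist Ω' (f x) (f y) = qhDist Ω x y) :
    ∃ F : E → E, ContinuousOn F (closure Ω) ∧ (∀ x ∈ Ω, F x = f x) ∧
      MapsTo F (closure Ω) (closure Ω') := by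
  have : ProperSpace E := FiniteDimensional.proper_real E
  have hcont := continuousOn_of_qhDist_eq hΩ hne hΩ' hne' hconn' hbdd' hmaps hiso
  have hcompact : IsCompact (closure Ω') := hbdd'.isCompact_closure
  have hev : ∀ p, ∀ᶠ x in 𝓝[Ω] p, f x ∈ closure Ω' := fun p => by
    filter_upwards [self_mem_nhdsWithin] with x hx using subset_closure (hmaps hx)
  have hlim : ∀ p ∈ closure Ω, ∃ q, Tendsto f (𝓝[Ω] p) (𝓝 q) := by
    intro p hp
    by_cases hpΩ : p ∈ Ω
    · exact ⟨f p, hcont p hpΩ⟩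
    have hpf : p ∈ frontier Ω := hΩ.frontier_eq ▸ ⟨hp, hpΩ⟩
    have : (𝓝[Ω] p).NeBot := mem_closure_iff_nhdsWithin_neBot.1 hp
    obtain ⟨q, -, hq⟩ := hcompact.exists_mapClusterPt_of_frequently (hev p).frequently
    obtain ⟨u, huΩ, hu, hfu⟩ := exists_seq_of_mapClusterPt hq
    refine ⟨q, hcompact.tendsto_nhds_of_unique_mapClusterPt (hev p) fun r _ hr => ?_⟩
    obtain ⟨v, hvΩ, hv, hfv⟩ := exists_seq_of_mapClusterPt hr
    exact eq_of_tendsto_of_qhVisibility hΩ hne hconn hbdd hΩ' hne' hconn' hWB hVis hmaps hiso hpf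
      hvΩ huΩ hv hu hfv hfu
  refine ⟨extendFrom Ω f, continuousOn_extendFrom Subset.rfl hlim, extendFrom_extends hcont,
    fun p hp => ?_⟩
  obtain ⟨q, hq⟩ := hlim p hp
  have : (𝓝[Ω] p).NeBot := mem_closure_iff_nhdsWithin_neBot.1 hp
  rw [extendFrom_eq hp hq]
  exact isClosed_closure.mem_of_tendsto hq (hev p)

end Extension

/-- If `Ω ⊆ ℝⁿ` is a quasihyperbolically well behaved bounded domain and
`Ω' ⊆ ℝⁿ` is a bounded QH-visibility domain, then every isometry of the quasihyperbolic
metrics `f : (Ω, k_Ω) → (Ω', k_Ω')` extends to a continuous map between the Euclidean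
closures. -/
theorem statement13 {n : ℕ} (Ω Ω' : Set (EuclideanSpace ℝ (Fin n)))
    (hOpen : IsOpen Ω) (hConn : IsConnected Ω) (hBdd : Bornology.IsBounded Ω)
    (hOpen' : IsOpen Ω') (hConn' : IsConnected Ω') (hBdd' : Bornology.IsBounded Ω')
    (hWB : QHWellBehaved Ω) (hVis : QHVisibilityDomain Ω')
    (f : EuclideanSpace ℝ (Fin n) → EuclideanSpace ℝ (Fin n))
    (hmaps : MapsTo f Ω Ω')
    (hiso : ∀ x ∈ Ω, ∀ y ∈ Ω, qhDist Ω' (f x) (f y) = qhDist Ω x y) :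
    ∃ F : EuclideanSpace ℝ (Fin n) → EuclideanSpace ℝ (Fin n),
      ContinuousOn F (closure Ω) ∧ (∀ x ∈ Ω, F x = f x) ∧
      MapsTo F (closure Ω) (closure Ω') := by
  rcases subsingleton_or_nontrivial (EuclideanSpace ℝ (Fin n)) with hsub | hnon
  · refine ⟨f, continuous_of_discreteTopology.continuousOn, fun _ _ => rfl, fun x hx => ?_⟩
    obtain ⟨z, hz⟩ := hConn.nonempty
    rw [Subsingleton.elim x z]
    exact subset_closure (hmaps hz)
  · have hne : ∀ {S : Set (EuclideanSpace ℝ (Fin n))}, Bornology.IsBounded S → (Sᶜ).Nonempty := by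
      intro S hS
      have := NormedSpace.noncompactSpace ℝ (EuclideanSpace ℝ (Fin n))
      rw [nonempty_compl]
      rintro rfl
      exact noncompact_univ _ (by simpa using hS.isCompact_closure)
    exact exists_continuousOn_closure_extension hOpen (hne hBdd) hConn hBdd hOpen' (hne hBdd')
      hConn'.isPreconnected hBdd' hWB hVis hmaps hiso

end
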